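/- (Fourier representation of the auxiliary problem.) Let ε > 0, b = (b₁, b₂) ∈ ℝ², h > 0, γ > 0 and θ = (θ₁, θ₂) ∈ ℝ². With s_j := sin(θ_j/2), c_j := cos(θ_j/2), Σ_j := B_ε(b_j) + B_ε(−b_j), define K_Φ(θ) := h⁻² [[2 s₂² Σ₂ − i sin(θ₂) b₂, −2 s₁ s₂ Σ₁ + 2 i s₂ c₁ b₁], [−2 s₁ s₂ Σ₂ + 2 i s₁ c₂ b₂, 2 s₁² Σ₁ − i sin(θ₁) b₁]], M_Φ(θ) := (1/3) diag(2 + cos θ₂, 2 + cos θ₁), H(θ) := [[b₁ c₁ + i s₁ Σ₁, 2 i s₂], [b₂ c₂ + i s₂ Σ₂, −2 i s₁]], and g(θ) := (−2 i s₁, −2 i s₂). Then g(θ) · (K_Φ(θ) + γ M_Φ(θ)) · (first column of H(θ)) = γ σ(θ), where σ(θ) := (1/6)[ 4(Σ₁ + Σ₂) + (B_ε(b₁) + B_ε(−b₁) − 4B_ε(−b₂)) e^{iθ₂} + (B_ε(b₁) + B_ε(−b₁) − 4B_ε(b₂)) e^{−iθ₂} + (B_ε(b₂) + B_ε(−b₂)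 − 4B_ε(−b₁)) e^{iθ₁} + (B_ε(b₂) + B_ε(−b₂) − 4B_ε(b₁)) e^{−iθ₁} − (B_ε(b₁) + B_ε(−b₂)) e^{i(−θ₁+θ₂)} − (B_ε(−b₁) + B_ε(−b₂)) e^{i(θ₁+θ₂)} − (B_ε(b₁) + B_ε(b₂)) e^{−i(θ₁+θ₂)} − (B_ε(−b₁) + B_ε(b₂)) e^{i(θ₁−θ₂)} ] is the Fourier symbol of the nine-point stencil of the SAFE scheme for the scalar H(grad) convection–diffusion problem. In other words, γ⁻¹ times the Fourier symbol of the auxiliary operator A^aux = G^T A J^grad_{ε,b} equals the Fourier symbol of the scalar SAFE node operator. -/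

import Mathlib

open Complex

/-- The Bernoulli function `B_ε(s) := ε / ∫_0^1 e^{s x / ε} dx`. -/
noncomputable def Bern (ε s : ℝ) : ℝ := ε / ∫ x in (0:ℝ)..1, Real.exp (s * x / ε)

/-- The change-of-basis matrix `H(θ)` of the Fourier–Helmholtz splitting:
`H(θ) = [[b₁c₁ + i s₁Σ₁, 2is₂], [b₂c₂ + i s₂Σ₂, −2is₁]]` with `s_j = sin(θ_j/2)`,
`c_j = cos(θ_j/2)`, `Σ_j = B_ε(b_j) + B_ε(−b_j)`. -/
noncomputable def Hmat (ε b₁ b₂ θ₁ θ₂ : ℝ) : Matrix (Fin 2) (Fin 2) ℂ :=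
  !![(b₁ : ℂ) * (Real.cos (θ₁ / 2) : ℂ)
        + I * (Real.sin (θ₁ / 2) : ℂ) * ((Bern ε b₁ : ℂ) + (Bern ε (-b₁) : ℂ)),
      2 * I * (Real.sin (θ₂ / 2) : ℂ);
    (b₂ : ℂ) * (Real.cos (θ₂ / 2) : ℂ)
        + I * (Real.sin (θ₂ / 2) : ℂ) * ((Bern ε b₂ : ℂ) + (Bern ε (-b₂) : ℂ)),
      -2 * I * (Real.sin (θ₁ / 2) : ℂ)]

/-- The Fourier representation matrix `K_Φ(θ)` of the SAFE stiffness edge operator: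
`K_Φ(θ) = h⁻²[[2s₂²Σ₂ − i sin(θ₂)b₂, −2s₁s₂Σ₁ + 2is₂c₁b₁],
              [−2s₁s₂Σ₂ + 2is₁c₂b₂, 2s₁²Σ₁ − i sin(θ₁)b₁]]`. -/
noncomputable def Kmat (ε b₁ b₂ h θ₁ θ₂ : ℝ) : Matrix (Fin 2) (Fin 2) ℂ :=
  ((h : ℂ) ^ 2)⁻¹ •
    !![2 * (Real.sin (θ₂ / 2) : ℂ) ^ 2 * ((Bern ε b₂ : ℂ) + (Bern ε (-b₂) : ℂ))
          - I * (Real.sin θ₂ : ℂ) * (b₂ : ℂ),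
        -2 * (Real.sin (θ₁ / 2) : ℂ) * (Real.sin (θ₂ / 2) : ℂ) *
            ((Bern ε b₁ : ℂ) + (Bern ε (-b₁) : ℂ))
          + 2 * I * (Real.sin (θ₂ / 2) : ℂ) * (Real.cos (θ₁ / 2) : ℂ) * (b₁ : ℂ);
      -2 * (Real.sin (θ₁ / 2) : ℂ) * (Real.sin (θ₂ / 2) : ℂ) *
            ((Bern ε b₂ : ℂ) + (Bern ε (-b₂) : ℂ))
          + 2 * I * (Real.sin (θ₁ / 2) : ℂ) * (Real.cos (θ₂ / 2) : ℂ) * (b₂ : ℂ),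
        2 * (Real.sin (θ₁ / 2) : ℂ) ^ 2 * ((Bern ε b₁ : ℂ) + (Bern ε (-b₁) : ℂ))
          - I * (Real.sin θ₁ : ℂ) * (b₁ : ℂ)]

/-- The Fourier representation matrix `M_Φ(θ) = (1/3) diag(2 + cos θ₂, 2 + cos θ₁)` of the
mass edge operator. -/
noncomputable def Mmat (θ₁ θ₂ : ℝ) : Matrix (Fin 2) (Fin 2) ℂ :=
  (3 : ℂ)⁻¹ • !![2 + (Real.cos θ₂ : ℂ), 0; 0, 2 + (Real.cos θ₁ : ℂ)]

/-- The Fourier symbol `g(θ) = (−2i sin(θ₁/2), −2i sin(θ₂/2))` of the transposed discrete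
gradient grid operator `Gᵀ`, as a row vector. -/
noncomputable def gvec (θ₁ θ₂ : ℝ) : Matrix (Fin 1) (Fin 2) ℂ :=
  !![-2 * I * (Real.sin (θ₁ / 2) : ℂ), -2 * I * (Real.sin (θ₂ / 2) : ℂ)]

/-- The Fourier symbol `σ(θ)` of the nine-point stencil of the SAFE scheme for the scalar
`H(grad)` convection–diffusion problem. -/
noncomputable def sigmaSymb (ε b₁ b₂ θ₁ θ₂ : ℝ) : ℂ :=
  (6 : ℂ)⁻¹ *
    (4 * (((Bern ε b₁ : ℂ) + (Bern ε (-b₁) : ℂ)) + ((Bern ε b₂ : ℂ) + (Bern ε (-b₂) : ℂ)))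
      + ((Bern ε b₁ : ℂ) + (Bern ε (-b₁) : ℂ) - 4 * (Bern ε (-b₂) : ℂ)) *
          Complex.exp (I * (θ₂ : ℂ))
      + ((Bern ε b₁ : ℂ) + (Bern ε (-b₁) : ℂ) - 4 * (Bern ε b₂ : ℂ)) *
          Complex.exp (-(I * (θ₂ : ℂ)))
      + ((Bern ε b₂ : ℂ) + (Bern ε (-b₂) : ℂ) - 4 * (Bern ε (-b₁) : ℂ)) *
          Complex.exp (I * (θ₁ : ℂ))
      + ((Bern ε b₂ : ℂ) + (Bern ε (-b₂) : ℂ) - 4 * (Bern ε b₁ : ℂ)) *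
          Complex.exp (-(I * (θ₁ : ℂ)))
      - ((Bern ε b₁ : ℂ) + (Bern ε (-b₂) : ℂ)) *
          Complex.exp (I * (-(θ₁ : ℂ) + (θ₂ : ℂ)))
      - ((Bern ε (-b₁) : ℂ) + (Bern ε (-b₂) : ℂ)) *
          Complex.exp (I * ((θ₁ : ℂ) + (θ₂ : ℂ)))
      - ((Bern ε b₁ : ℂ) + (Bern ε b₂ : ℂ)) *
          Complex.exp (-(I * ((θ₁ : ℂ) + (θ₂ : ℂ))))
      - ((Bern ε (-b₁) : ℂ) + (Bern ε b₂ : ℂ)) *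
          Complex.exp (I * ((θ₁ : ℂ) - (θ₂ : ℂ))))

theorem mul_integral_exp_mul (c : ℝ) :
    c * ∫ x in (0:ℝ)..1, Real.exp (c * x) = Real.exp c - 1 := by
  rw [intervalIntegral.mul_integral_comp_mul_left (f := Real.exp), integral_exp]
  simp

theorem integral_exp_neg_mul (c : ℝ) :
    ∫ x in (0:ℝ)..1, Real.exp (-c * x)
      = Real.exp (-c) * ∫ x in (0:ℝ)..1, Real.exp (c * x) := by
  have h := intervalIntegral.integral_comp_sub_left
    (a := (0:ℝ)) (b := 1) (fun x : ℝ => Real.exp (-c * x)) 1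
  rw [sub_self, sub_zero] at h
  rw [← h, ← intervalIntegral.integral_const_mul]
  congr 1
  ext x
  rw [← Real.exp_add]
  congr 1
  ring

theorem integral_exp_mul_pos (c : ℝ) : 0 < ∫ x in (0:ℝ)..1, Real.exp (c * x) :=
  intervalIntegral.intervalIntegral_pos_of_pos
    (Continuous.intervalIntegrable (by fun_prop) _ _) (fun _ => Real.exp_pos _) one_pos

theorem Bern_eq (ε s : ℝ) : Bern ε s = ε / ∫ x in (0:ℝ)..1, Real.exp (s / ε * x) := by
  simp only [Bern, div_mul_eq_mul_div]

/-- The Bernoulli function satisfies `B_ε(-s) - B_ε(s) = s`. -/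
theorem Bern_neg_sub_Bern {ε : ℝ} (hε : ε ≠ 0) (s : ℝ) : Bern ε (-s) - Bern ε s = s := by
  have hJ := (integral_exp_mul_pos (s / ε)).ne'
  have hmul := mul_integral_exp_mul (s / ε)
  rw [Bern_eq, Bern_eq, neg_div, integral_exp_neg_mul, Real.exp_neg]
  generalize (∫ x in (0:ℝ)..1, Real.exp (s / ε * x)) = J at hJ hmul ⊢
  have hs : s * J = ε * (Real.exp (s / ε) - 1) := by
    rw [← hmul]
    field_simp
  have he := Real.exp_ne_zero (s / ε)
  generalize Real.exp (s / ε) = E at hs he ⊢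
  field_simp
  linear_combination -hs

theorem gvec_mul_Kmat (ε b₁ b₂ h θ₁ θ₂ : ℝ) :
    gvec θ₁ θ₂ * Kmat ε b₁ b₂ h θ₁ θ₂ = 0 := by
  have hsin (θ : ℝ) : Real.sin θ = 2 * Real.sin (θ / 2) * Real.cos (θ / 2) := by
    rw [← Real.sin_two_mul]
    ring_nf
  rw [gvec, Kmat, hsin θ₁, hsin θ₂]
  push_cast
  ext i j
  fin_cases i
  fin_cases j <;> simp [Matrix.mul_apply, Fin.sum_univ_two] <;> ring

/-- The product of the symbols of the transposed gradient and of the gradient flux in one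
coordinate direction, with `p = B_ε(b)` and `m = B_ε(-b)`. -/
theorem neg_two_I_sin_mul_flux (p m : ℂ) (θ : ℝ) :
    -2 * I * (Real.sin (θ / 2) : ℂ) *
        ((m - p) * (Real.cos (θ / 2) : ℂ) + I * (Real.sin (θ / 2) : ℂ) * (p + m))
      = p + m - m * exp (I * θ) - p * exp (-(I * θ)) := by
  have hpos : exp (I * θ) = exp (θ / 2 * I) ^ 2 := by
    rw [← exp_nat_mul]
    congr 1
    push_cast
    ring
  have hneg : exp (-(I * θ)) = exp (-(θ / 2) * I) ^ 2 := by
    rw [← exp_nat_mul]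
    congr 1
    push_cast
    ring
  have hinv : exp (θ / 2 * I) * exp (-(θ / 2) * I) = 1 := by
    rw [← exp_add]
    simp
  rw [hpos, hneg]
  push_cast
  rw [Complex.sin, Complex.cos]
  generalize exp ((θ : ℂ) / 2 * I) = x at hinv ⊢
  generalize exp (-((θ : ℂ) / 2) * I) = y at hinv ⊢
  linear_combination (p + m) * hinv
    + ((m - p) * (x ^ 2 - y ^ 2) / 2 - (m + p) * (x - y) ^ 2 / 2 * (I ^ 2 - 1)) * I_sq

theorem sigmaSymb_eq (ε b₁ b₂ θ₁ θ₂ : ℝ) :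
    sigmaSymb ε b₁ b₂ θ₁ θ₂ = (3 : ℂ)⁻¹ *
      ((2 + (Real.cos θ₂ : ℂ)) * ((Bern ε b₁ : ℂ) + Bern ε (-b₁)
          - Bern ε (-b₁) * exp (I * θ₁) - Bern ε b₁ * exp (-(I * θ₁)))
        + (2 + (Real.cos θ₁ : ℂ)) * ((Bern ε b₂ : ℂ) + Bern ε (-b₂)
          - Bern ε (-b₂) * exp (I * θ₂) - Bern ε b₂ * exp (-(I * θ₂)))) := by
  rw [sigmaSymb, ofReal_cos, ofReal_cos, Complex.cos, Complex.cos]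
  simp only [mul_add, mul_neg, neg_add, sub_eq_add_neg, exp_add, mul_comm _ I]
  ring

/-- Fourier representation of the auxiliary problem: `γ⁻¹` times the Fourier symbol of
`A^aux = Gᵀ A J^grad_{ε,b}` equals the Fourier symbol `σ(θ)` of the scalar SAFE node
operator, i.e. `g(θ)·(K_Φ(θ) + γM_Φ(θ))·(first column of H(θ)) = γ σ(θ)`. -/
theorem aux_symbol_eq_scalar_safe (ε b₁ b₂ h γ θ₁ θ₂ : ℝ) (hε : 0 < ε) (hh : 0 < h)
    (hγ : 0 < γ) :
    gvec θ₁ θ₂ * (Kmat ε b₁ b₂ h θ₁ θ₂ + (γ : ℂ) • Mmat θ₁ θ₂) *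
        !![Hmat ε b₁ b₂ θ₁ θ₂ 0 0; Hmat ε b₁ b₂ θ₁ θ₂ 1 0]
      = !![(γ : ℂ) * sigmaSymb ε b₁ b₂ θ₁ θ₂] := by
  have hflux (b θ : ℝ) :
      -2 * I * (Real.sin (θ / 2) : ℂ) * ((b : ℂ) * (Real.cos (θ / 2) : ℂ)
          + I * (Real.sin (θ / 2) : ℂ) * ((Bern ε b : ℂ) + (Bern ε (-b) : ℂ)))
        = (Bern ε b : ℂ) + Bern ε (-b) - Bern ε (-b) * exp (I * θ)
          - Bern ε b * exp (-(I * θ)) := by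
    rw [← neg_two_I_sin_mul_flux, ← ofReal_sub, Bern_neg_sub_Bern hε.ne']
  rw [Matrix.mul_add, gvec_mul_Kmat, zero_add, sigmaSymb_eq, ← hflux b₁ θ₁, ← hflux b₂ θ₂,
    gvec, Mmat, Hmat]
  ext i j
  fin_cases i
  fin_cases j
  simp [Matrix.mul_apply, Fin.sum_univ_two]
  ring
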